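/- arXiv:math/0307054 — 4 statements merged into one kernel-verified Lean document; each statement's English description precedes it below -/
import Mathlib

section
/- (Proposition 3.2) Let B be a non-graded symmetric brace algebra. For a B-decorated rooted tree T, let T(·) ∈ B denote its evaluation, defined recursively by: a decorated singleton evaluates to its decoration, and (root b with subtrees T₁,…,T_m) evaluates to b⟨T₁(·),…,T_m(·)⟩. Then for any B-decorated rooted trees S, S₁,…,S_n (n ≥ 1): S(·)⟨S₁(·),…,S_n(·)⟩ = Σ_{v} (S with S_i grafted by a new edge from the root of S_i to the vertex v(S_i), for i = 1,…,n)(·), where the sum runs over all functions v from {S₁,…,S_n} to the set of vertices of S, and the grafted tree carries the decoration inherited from S, S₁,…,S_n. -/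
open scoped Classical

noncomputable section

/-- A non-graded symmetric brace algebra: braces `x⟨x₁,…,x_n⟩` (the list argument),
multilinear, symmetric in the list entries, with `x⟨⟩ = x` and the composition axiom,
whose sum runs over all decompositions of the arguments `y₁,…,y_n` into `m+1` blocks
(encoded by a function `f` assigning to each `yⱼ` a block). -/
structure NGSymBrace (K B : Type) [Field K] [AddCommGroup B] [Module K B] where
  brace : B → List B → B
  brace_nil : ∀ x, brace x [] = x
  add_head : ∀ x y l, brace (x + y) l = brace x l + brace y l
  smul_head : ∀ (c : K) (x : B) l, brace (c • x) l = c • brace x l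
  add_entry : ∀ x l₁ (y y' : B) l₂,
    brace x (l₁ ++ (y + y') :: l₂) = brace x (l₁ ++ y :: l₂) + brace x (l₁ ++ y' :: l₂)
  smul_entry : ∀ x l₁ (c : K) (y : B) l₂,
    brace x (l₁ ++ (c • y) :: l₂) = c • brace x (l₁ ++ y :: l₂)
  symm : ∀ x l₁ (y z : B) l₂,
    brace x (l₁ ++ y :: z :: l₂) = brace x (l₁ ++ z :: y :: l₂)
  comp : ∀ (x : B) (xs ys : List B),
    brace (brace x xs) ys =
      ∑ f : Fin ys.length → Fin (xs.length + 1),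
        brace x
          (((List.finRange xs.length).map fun t =>
              brace (xs.get t)
                (((List.finRange ys.length).filter fun j => (f j : ℕ) = (t : ℕ)).map ys.get)) ++
            ((List.finRange ys.length).filter fun j => (f j : ℕ) = xs.length).map ys.get)

/-- Rooted trees with vertices decorated by `X` (the root together with the list of
subtrees grafted at it). -/
inductive RTree (X : Type) : Type
  | node : X → List (RTree X) → RTree X

/-- Grafting `T` onto `S` at the vertex addressed by a path (list of child indices);
the new edge attaches the root of `T` to that vertex. -/
def RTree.graft {X : Type} : List ℕ → RTree X → RTree X → RTree X
  | [], .node b ts, T => .node b (ts ++ [T])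
  | i :: p, .node b ts, T =>
      .node b (ts.mapIdx fun j s => if j = i then RTree.graft p s T else s)

/-- The path `p` addresses a vertex of the tree. -/
def RTree.IsVert {X : Type} : List ℕ → RTree X → Prop
  | [], _ => True
  | i :: p, .node _ ts => ∃ h : i < ts.length, RTree.IsVert p (ts.get ⟨i, h⟩)

/-- Evaluation of a `B`-decorated rooted tree in a symmetric brace algebra:
a singleton evaluates to its decoration, and a root `b` with subtrees `T₁,…,T_m`
evaluates to `b⟨T₁(·),…,T_m(·)⟩`. -/
def RTree.eval {K B : Type} [Field K] [AddCommGroup B] [Module K B]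
    (A : NGSymBrace K B) : RTree B → B
  | .node b ts => A.brace b (ts.attach.map fun t => RTree.eval A t.1)
  decreasing_by
    have := List.sizeOf_lt_of_mem t.2
    simp only [RTree.node.sizeOf_spec]
    omega

/-- Simultaneous grafting of the trees `Ss 0, …, Ss (n−1)` onto `S` along the
assignment `v` of vertices (paths) of `S`. -/
def RTree.multigraft {X : Type} (n : ℕ) (S : RTree X) (v : Fin n → List ℕ)
    (Ss : Fin n → RTree X) : RTree X :=
  (List.finRange n).foldl (fun acc t => RTree.graft (v t) acc (Ss t)) S

theorem RTree.induct {X : Type} {P : RTree X → Prop}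
    (h : ∀ b ts, (∀ t ∈ ts, P t) → P (.node b ts)) : ∀ S, P S
  | .node b ts => h b ts fun t _ => RTree.induct h t
  decreasing_by
    have := List.sizeOf_lt_of_mem ‹t ∈ ts›
    simp only [RTree.node.sizeOf_spec]
    omega

theorem RTree.eval_node {K B : Type} [Field K] [AddCommGroup B] [Module K B]
    (A : NGSymBrace K B) (b : B) (ts : List (RTree B)) :
    RTree.eval A (.node b ts) = A.brace b (ts.map (RTree.eval A)) := by
  rw [RTree.eval]
  simp

theorem List.ofFn_update_eq {α : Type*} {m : ℕ} (v : Fin m → α) (i : Fin m) (a : α) :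
    List.ofFn (Function.update v i a) =
      (List.ofFn v).take i ++ a :: (List.ofFn v).drop (i + 1) := by
  trans (List.ofFn v).set i a
  · apply List.ext_getElem
    · simp
    · intro k h₁ h₂
      simp [List.getElem_set, Function.update_apply, Fin.ext_iff, eq_comm]
  · simp [List.set_eq_take_append_cons_drop]

/-- The brace as a multilinear map in its first `m` entries. -/
def NGSymBrace.multilinear {K B : Type} [Field K] [AddCommGroup B] [Module K B]
    (A : NGSymBrace K B) (x : B) (m : ℕ) (l : List B) :
    MultilinearMap K (fun _ : Fin m => B) B where
  toFun v := A.brace x (List.ofFn v ++ l)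
  map_update_add' {inst} v i a a' := by
    rw [Subsingleton.elim inst (instDecidableEqFin m)]
    simp only [List.ofFn_update_eq, List.append_assoc, List.cons_append, A.add_entry]
  map_update_smul' {inst} v i c a := by
    rw [Subsingleton.elim inst (instDecidableEqFin m)]
    simp only [List.ofFn_update_eq, List.append_assoc, List.cons_append, A.smul_entry]

theorem NGSymBrace.brace_sum {K B : Type} [Field K] [AddCommGroup B] [Module K B]
    (A : NGSymBrace K B) (x : B) {m : ℕ} (l : List B) {α : Type} (W : Fin m → Finset α)
    (g : Fin m → α → B) :
    A.brace x (List.ofFn (fun t => ∑ w ∈ W t, g t w) ++ l) =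
      ∑ r ∈ Fintype.piFinset W, A.brace x (List.ofFn (fun t => g t (r t)) ++ l) :=
  (A.multilinear x m l).map_sum_finset g W

theorem List.map_get_filter_finRange {α β : Type*} (L : List α) (y : α → β) (p : α → Prop)
    [DecidablePred p] :
    ((List.finRange L.length).filter fun j => p (L.get j)).map (fun j => y (L.get j)) =
      (L.filter p).map y := by
  conv_rhs => rw [← List.map_get_finRange L]
  rw [List.filter_map, List.map_map]
  rfl

/-- The composition axiom with the arguments indexed by a duplicate-free list. -/
theorem NGSymBrace.comp_index {K B : Type} [Field K] [AddCommGroup B] [Module K B]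
    (A : NGSymBrace K B) {ι : Type} [Fintype ι] [DecidableEq ι] (x : B) {m : ℕ}
    (xs : Fin m → B) (L : List ι) (hL : L.Nodup) (y : ι → B) :
    A.brace (A.brace x (List.ofFn xs)) (L.map y) =
      ∑ f ∈ Fintype.piFinset
          (fun j => if j ∈ L then (Finset.univ : Finset (Fin (m + 1))) else {Fin.last m}),
        A.brace x
          (List.ofFn (fun t => A.brace (xs t) ((L.filter fun j => (f j : ℕ) = (t : ℕ)).map y)) ++
            (L.filter fun j => (f j : ℕ) = m).map y) := by
  obtain ⟨l, hl, hxs⟩ : ∃ l : List B, ∃ h : l.length = m, xs = fun t => l.get (t.cast h.symm) :=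
    ⟨List.ofFn xs, by simp, by ext; simp⟩
  subst hl hxs
  obtain ⟨z, hz, hy⟩ : ∃ z : List B, ∃ h : L.length = z.length,
      z = L.map y ∧ ∀ j, z.get j = y (L.get (j.cast h.symm)) :=
    ⟨L.map y, by simp, rfl, by simp⟩
  rw [← hy.1]
  simp only [Fin.cast_eq_self, List.ofFn_get]
  rw [A.comp]
  refine Finset.sum_bij'
    (fun g _ j => if h : j ∈ L then
      g ⟨L.idxOf j, hz ▸ List.idxOf_lt_length_of_mem h⟩ else Fin.last _)
    (fun f _ j => f (L.get (j.cast hz.symm))) ?_ ?_ ?_ ?_ ?_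
  · intro g _
    rw [Fintype.mem_piFinset]
    intro j
    by_cases h : j ∈ L <;> simp [h]
  · simp
  · intro g _
    ext j
    simp [hL.idxOf_getElem]
  · intro f hf
    rw [Fintype.mem_piFinset] at hf
    ext j
    have := hf j
    by_cases h : j ∈ L
    · simp [h]
    · simp_all
  · intro g _
    have key : ∀ k : ℕ,
        ((List.finRange z.length).filter fun j => (g j : ℕ) = k).map z.get =
        (L.filter fun j => ((if h : j ∈ L then
          g ⟨L.idxOf j, hz ▸ List.idxOf_lt_length_of_mem h⟩ else Fin.last _ :
            Fin (l.length + 1)) : ℕ) = k).map y := by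
      intro k
      rw [← List.map_get_filter_finRange L y]
      have hr : List.finRange z.length = (List.finRange L.length).map (Fin.cast hz) := by
        apply List.ext_getElem <;> simp [hz]
      rw [hr, List.filter_map, List.map_map]
      congr 1
      · funext j
        exact hy.2 _
      · congr 1
        funext j
        simp [hL.idxOf_getElem]
        rfl
    simp only [key, List.ofFn_eq_map]

/-- Successive grafting along the indices in a list. -/
def RTree.graftList {X ι : Type} (Ss : ι → RTree X) (L : List ι) (S : RTree X) (v : ι → List ℕ) : RTree X :=
  L.foldl (fun acc t => RTree.graft (v t) acc (Ss t)) S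

/-- Assemble vertices of a tree with `m` subtrees from a choice `f` of subtree
(or of the root, encoded by the last index) and of a vertex in each subtree. -/
def joinPaths {ι : Type} {m : ℕ} (f : ι → Fin (m + 1)) (w : Fin m → ι → List ℕ) (j : ι) : List ℕ :=
  if h : (f j : ℕ) < m then (f j : ℕ) :: w ⟨f j, h⟩ j else []

theorem RTree.graftList_node {X ι : Type} (Ss : ι → RTree X) (L : List ι) (b : X) {m : ℕ}
    (c : Fin m → RTree X) (f : ι → Fin (m + 1)) (w : Fin m → ι → List ℕ) :
    RTree.graftList Ss L (.node b (List.ofFn c)) (joinPaths f w) =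
      .node b (List.ofFn (fun t => RTree.graftList Ss
          (L.filter fun j => (f j : ℕ) = (t : ℕ)) (c t) (w t)) ++
        (L.filter fun j => (f j : ℕ) = m).map Ss) := by
  induction L using List.reverseRecOn with
  | nil => simp [RTree.graftList]
  | append_singleton L a ih =>
    have step : RTree.graftList Ss (L ++ [a]) (.node b (List.ofFn c)) (joinPaths f w) =
        RTree.graft (joinPaths f w a)
          (RTree.graftList Ss L (.node b (List.ofFn c)) (joinPaths f w)) (Ss a) := by
      simp [RTree.graftList]
    rw [step, ih]
    by_cases h : (f a : ℕ) < m
    · have hm : (f a : ℕ) ≠ m := h.ne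
      simp only [joinPaths, h, dite_true, RTree.graft, List.filter_append]
      congr 1
      apply List.ext_getElem
      · simp [hm]
      · intro k h₁ h₂
        simp only [List.getElem_mapIdx, List.getElem_append, List.length_ofFn, List.getElem_ofFn]
        by_cases hk : k < m
        · by_cases hka : k = f a
          · subst hka
            simp [h, RTree.graftList]
          · simp [hk, hka, Ne.symm hka]
        · have : k ≠ f a := by omega
          simp [hk, this, hm]
    · have hm : (f a : ℕ) = m := by have := (f a).isLt; omega
      have hne : ∀ t : Fin m, ¬ m = (t : ℕ) := fun t => t.isLt.ne'
      simp [joinPaths, hm, RTree.graft, List.filter_append, hne]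

theorem RTree.isVert_cons_ofFn {X : Type} (b : X) {m : ℕ} (c : Fin m → RTree X)
    (i : ℕ) (p : List ℕ) :
    RTree.IsVert (i :: p) (.node b (List.ofFn c)) ↔ ∃ h : i < m, RTree.IsVert p (c ⟨i, h⟩) := by
  simp [RTree.IsVert]

theorem RTree.brace_eval {K B : Type} [Field K] [AddCommGroup B] [Module K B]
    (A : NGSymBrace K B) {ι : Type} [Fintype ι] [DecidableEq ι] (Ss : ι → RTree B)
    (S : RTree B) : ∀ (L : List ι), L.Nodup → ∀ (VS : Finset (List ℕ)),
      (∀ p, p ∈ VS ↔ RTree.IsVert p S) →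
      A.brace (RTree.eval A S) (L.map fun t => RTree.eval A (Ss t)) =
        ∑ v ∈ Fintype.piFinset (fun j => if j ∈ L then VS else {[]}),
          RTree.eval A (RTree.graftList Ss L S v) := by
  induction S using RTree.induct with
  | h b ts ih =>
  intro L hL VS hVS
  obtain ⟨m, c, rfl⟩ : ∃ m, ∃ c : Fin m → RTree B, ts = List.ofFn c :=
    ⟨_, ts.get, (List.ofFn_get ts).symm⟩
  let V : Fin m → Finset (List ℕ) := fun t =>
    VS.preimage (fun p => (t : ℕ) :: p) (by intro _ _ _ _ h; simpa using h)
  have hV : ∀ t p, p ∈ V t ↔ RTree.IsVert p (c t) := by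
    intro t p
    refine Finset.mem_preimage.trans ?_
    rw [hVS, RTree.isVert_cons_ofFn]
    simp
  have hVS' : ∀ p, p ∈ VS ↔ p = [] ∨ ∃ (t : Fin m) (q : List ℕ), q ∈ V t ∧ p = (t : ℕ) :: q := by
    intro p
    rcases p with _ | ⟨i, p⟩
    · simp [hVS, RTree.IsVert]
    · rw [hVS, RTree.isVert_cons_ofFn]
      constructor
      · rintro ⟨h, hp⟩
        exact Or.inr ⟨⟨i, h⟩, p, (hV _ _).2 hp, rfl⟩
      · rintro (h | ⟨t, q, hq, h⟩)
        · simp at h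
        · obtain ⟨rfl, rfl⟩ := List.cons.inj h
          exact ⟨t.isLt, (hV _ _).1 hq⟩
  have hc : ∀ t (f : ι → Fin (m + 1)), _ := fun t f =>
    ih (c t) (by simp) (L.filter fun j => (f j : ℕ) = (t : ℕ)) (hL.filter _) (V t) (hV t)
  rw [RTree.eval_node, List.map_ofFn, A.comp_index b _ L hL]
  simp only [Function.comp_apply, hc, A.brace_sum]
  rw [Finset.sum_sigma']
  refine Finset.sum_bij' (fun fw _ => joinPaths fw.1 fw.2)
    (fun v _ => ⟨fun j => (v j).head?.elim (Fin.last m) fun i =>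
        if h : i < m then Fin.castSucc ⟨i, h⟩ else Fin.last m,
      fun t j => if (v j).head? = some (t : ℕ) then (v j).tail else []⟩) ?_ ?_ ?_ ?_ ?_
  · rintro ⟨f, w⟩ h
    simp only [Finset.mem_sigma, Fintype.mem_piFinset] at h ⊢
    obtain ⟨hf, hw⟩ := h
    intro j
    have hfj := hf j
    by_cases hj : j ∈ L
    · simp only [hj, if_true, hVS', joinPaths]
      split_ifs with h
      · have := hw ⟨f j, h⟩ j
        simp only [List.mem_filter, hj, true_and, decide_true, if_true] at this
        exact Or.inr ⟨_, _, this, rfl⟩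
      · exact Or.inl rfl
    · simp_all [joinPaths]
  · intro v hv
    simp only [Finset.mem_sigma, Fintype.mem_piFinset] at hv ⊢
    refine ⟨fun j => ?_, fun t j => ?_⟩
    · have := hv j
      by_cases hj : j ∈ L <;> simp_all
    · have := hv j
      by_cases hj : j ∈ L
      · simp only [hj, if_true, hVS'] at this
        rcases this with h | ⟨s, q, hq, h⟩
        · simp [h, t.isLt.ne']
        · by_cases hst : s = t
          · subst hst
            simp [h, hj, hq]
          · simp [h, Fin.val_ne_of_ne hst]
      · simp_all
  · rintro ⟨f, w⟩ h
    simp only [Finset.mem_sigma, Fintype.mem_piFinset] at h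
    obtain ⟨hf, hw⟩ := h
    have hff : (fun j => (joinPaths f w j).head?.elim (Fin.last m) fun i =>
        if h : i < m then Fin.castSucc ⟨i, h⟩ else Fin.last m) = f := by
      ext j
      by_cases h : (f j : ℕ) < m
      · simp [joinPaths, h]
      · have := (f j).isLt
        simp [joinPaths, h]
        omega
    have hww : (fun (t : Fin m) j => if (joinPaths f w j).head? = some (t : ℕ) then
        (joinPaths f w j).tail else []) = w := by
      funext t j
      have hwt := hw t j
      by_cases h : (f j : ℕ) = t
      · simp [joinPaths, h]
      · have : w t j = [] := by simpa [h] using hwt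
        rw [this]
        by_cases h' : (f j : ℕ) < m <;> simp [joinPaths, h, h']
    simp only [hff, hww]
  · intro v hv
    simp only [Fintype.mem_piFinset] at hv
    funext j
    have := hv j
    by_cases hj : j ∈ L
    · simp only [hj, if_true, hVS'] at this
      rcases this with h | ⟨s, q, hq, h⟩
      · simp [h, joinPaths]
      · simp [h, joinPaths]
    · simp_all [joinPaths]
  · rintro ⟨f, w⟩ _
    simp only [RTree.graftList_node, RTree.eval_node, List.map_append, List.map_ofFn, List.map_map]
    rfl

/-- Proposition 3.2. For `B`-decorated rooted trees `S, S₁,…,S_n`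
(`n ≥ 1`) and any symmetric brace algebra `B`:
`S(·)⟨S₁(·),…,S_n(·)⟩ = Σ_v (S with each Sᵢ grafted at the vertex v(Sᵢ))(·)`,
the sum running over all functions `v` assigning to each `Sᵢ` a vertex of `S`
(`VS` is the finite set of vertices — paths — of `S`). -/
theorem stmt7 (K B : Type) [Field K] [AddCommGroup B] [Module K B]
    (A : NGSymBrace K B) (n : ℕ) (hn : 1 ≤ n)
    (S : RTree B) (Ss : Fin n → RTree B)
    (VS : Finset (List ℕ)) (hVS : ∀ p, p ∈ VS ↔ RTree.IsVert p S) :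
    A.brace (RTree.eval A S) ((List.finRange n).map fun t => RTree.eval A (Ss t)) =
      ∑ v ∈ Fintype.piFinset (fun _ : Fin n => VS),
        RTree.eval A (RTree.multigraft n S v Ss) := by
  have h := RTree.brace_eval A Ss S (List.finRange n) (List.nodup_finRange n) VS hVS
  simp only [List.mem_finRange, if_true] at h
  exact h
end
end

section
/- (Proposition 3.4, Guin–Oudom) Every non-graded right pre-Lie algebra (P, ∘) carries a unique structure of non-graded symmetric brace algebra whose one-argument brace is the pre-Lie product, x⟨y⟩ = x ∘ y; moreover every homomorphism of pre-Lie algebras is automatically a homomorphism of the corresponding symmetric brace algebras. Consequently the category of non-graded symmetric brace algebras is isomorphic to the category of non-graded right pre-Lie algebras. -/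
open scoped Classical

noncomputable section

namespace PreLie

open Function

section Substitution

variable {A M N : Type} [AddCommGroup M] [AddCommGroup N]

/-- The sum of `F` over the lists obtained from the given one by applying `d` to one entry. -/
def derivSum (d : A → A) : List A → (List A → M) → M
  | [], _ => 0
  | z :: l, F => F (d z :: l) + derivSum d l fun l' => F (z :: l')

theorem derivSum_congr (d : A → A) (l : List A) {F G : List A → M}
    (h : ∀ l', l'.length = l.length → F l' = G l') : derivSum d l F = derivSum d l G := by
  induction l generalizing F G with
  | nil => rfl
  | cons z l ih =>
    simp only [derivSum]
    rw [h _ (by simp), ih fun l' hl' => h _ (by simp [hl'])]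

theorem derivSum_add (d : A → A) (l : List A) (F G : List A → M) :
    derivSum d l (fun l' => F l' + G l') = derivSum d l F + derivSum d l G := by
  induction l generalizing F G with
  | nil => simp [derivSum]
  | cons z l ih => simp only [derivSum, ih]; abel

theorem derivSum_map (d : A → A) (l : List A) (g : M →+ N) (F : List A → M) :
    derivSum d l (fun l' => g (F l')) = g (derivSum d l F) := by
  induction l generalizing F with
  | nil => simp [derivSum]
  | cons z l ih => simp only [derivSum, ih, map_add]

theorem derivSum_sub (d : A → A) (l : List A) (F G : List A → M) :
    derivSum d l (fun l' => F l' - G l') = derivSum d l F - derivSum d l G := by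
  induction l generalizing F G with
  | nil => simp [derivSum]
  | cons z l ih => simp only [derivSum, ih]; abel

theorem derivSum_sum {ι : Type} (s : Finset ι) (d : A → A) (l : List A) (F : ι → List A → M) :
    derivSum d l (fun l' => ∑ i ∈ s, F i l') = ∑ i ∈ s, derivSum d l (F i) := by
  induction l generalizing F with
  | nil => simp [derivSum]
  | cons z l ih => simp only [derivSum, ih, Finset.sum_add_distrib]

theorem derivSum_append (d : A → A) (l₁ l₂ : List A) (F : List A → M) :
    derivSum d (l₁ ++ l₂) F =
      derivSum d l₁ (fun l => F (l ++ l₂)) + derivSum d l₂ fun l => F (l₁ ++ l) := by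
  induction l₁ generalizing F with
  | nil => simp [derivSum]
  | cons z l ih => simp only [List.cons_append, derivSum, ih, add_assoc]

theorem derivSum_list_map {B : Type} (ψ : A → B) (d : A → A) (e : B → B)
    (h : ∀ z, ψ (d z) = e (ψ z)) (l : List A) (F : List B → M) :
    derivSum e (l.map ψ) F = derivSum d l fun l' => F (l'.map ψ) := by
  induction l generalizing F with
  | nil => rfl
  | cons z l ih => simp only [List.map_cons, derivSum, ih, h]

theorem derivSum_ofFn {n : ℕ} (d : A → A) (g : Fin n → A) (F : List A → M) :
    derivSum d (List.ofFn g) F = ∑ t, F (List.ofFn (update g t (d (g t)))) := by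
  induction n generalizing F with
  | zero => simp [derivSum]
  | succ n ih =>
    rw [List.ofFn_succ, derivSum, ih, Fin.sum_univ_succ]
    congr 1
    · rw [List.ofFn_succ]
      simp [update_of_ne]
    · refine Finset.sum_congr rfl fun t _ => ?_
      rw [List.ofFn_succ]
      congr 3
      funext i
      by_cases hi : i = t
      · subst hi; simp
      · rw [update_of_ne hi, update_of_ne (by simpa using hi)]

end Substitution

section Distribution

variable {A M N : Type} [AddCommGroup M] [AddCommGroup N] {k : ℕ}

/-- Put `y` in front of the block with index `t`. -/
def push (t : Fin k) (y : A) (c : Fin k → List A) : Fin k → List A :=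
  update c t (y :: c t)

/-- The sum of `φ` over all distributions of the entries of the list into `k` blocks. -/
def distribSum : List A → ((Fin k → List A) → M) → M
  | [], φ => φ fun _ => []
  | y :: l, φ => ∑ t, distribSum l fun c => φ (push t y c)

/-- The blocks of the list `l` determined by the assignment `f` of blocks to positions. -/
def block (l : List A) (f : Fin l.length → Fin k) (t : Fin k) : List A :=
  ((List.finRange l.length).filter fun j => f j = t).map l.get

theorem block_cons (y : A) (l : List A) (s : Fin k) (f : Fin l.length → Fin k) :
    block (y :: l) (Fin.cons s f : Fin (l.length + 1) → Fin k) = push s y (block l f) := by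
  funext t
  unfold block push
  simp only [List.length_cons, List.finRange_succ, List.filter_cons, List.filter_map]
  by_cases h : s = t
  · subst h
    simp [Function.comp_def]
  · simp [Function.comp_def, h, update_of_ne (Ne.symm h)]

theorem distribSum_eq_sum (l : List A) (φ : (Fin k → List A) → M) :
    distribSum l φ = ∑ f : Fin l.length → Fin k, φ (block l f) := by
  induction l generalizing φ with
  | nil =>
    exact (Fintype.sum_unique fun f : Fin 0 → Fin k => φ (block [] f)).symm
  | cons y l ih =>
    simp only [distribSum, ih]
    refine Eq.trans ?_ ((Fin.consEquiv fun _ : Fin (l.length + 1) => Fin k).sum_comp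
      fun f => φ (block (y :: l) f))
    rw [Fintype.sum_prod_type]
    refine Finset.sum_congr rfl fun s _ => Finset.sum_congr rfl fun f _ => ?_
    rw [← block_cons]
    rfl

theorem distribSum_add (l : List A) (φ χ : (Fin k → List A) → M) :
    distribSum l (fun c => φ c + χ c) = distribSum l φ + distribSum l χ := by
  simp only [distribSum_eq_sum, Finset.sum_add_distrib]

theorem distribSum_sum {ι : Type} (s : Finset ι) (l : List A)
    (φ : ι → (Fin k → List A) → M) :
    distribSum l (fun c => ∑ i ∈ s, φ i c) = ∑ i ∈ s, distribSum l (φ i) := by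
  simp only [distribSum_eq_sum]
  exact Finset.sum_comm

theorem distribSum_map (l : List A) (g : M →+ N) (φ : (Fin k → List A) → M) :
    distribSum l (fun c => g (φ c)) = g (distribSum l φ) := by
  simp only [distribSum_eq_sum, map_sum]

/-- Applying `d` to one entry and then distributing amounts to distributing and then
applying `d` to one entry of one block. -/
theorem derivSum_distribSum (d : A → A) (l : List A) (φ : (Fin k → List A) → M) :
    derivSum d l (fun l' => distribSum l' φ) =
      distribSum l fun c => ∑ t, derivSum d (c t) fun l' => φ (update c t l') := by
  induction l generalizing φ with
  | nil => simp [derivSum, distribSum]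
  | cons z l ih =>
    simp only [derivSum, distribSum]
    rw [derivSum_sum, ← Finset.sum_add_distrib]
    refine Finset.sum_congr rfl fun s _ => ?_
    rw [ih, ← distribSum_add]
    congr 1
    funext c
    rw [← Finset.add_sum_erase _ _ (Finset.mem_univ s),
      ← Finset.add_sum_erase (a := s) _ _ (Finset.mem_univ s), ← add_assoc]
    congr 1
    · simp [push, derivSum]
    · refine Finset.sum_congr rfl fun t ht => ?_
      have hts : t ≠ s := Finset.ne_of_mem_erase ht
      have h : push s z c t = c t := by simp [push, hts]
      rw [h]
      congr 1
      funext l'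
      simp only [push, update_of_ne hts.symm]
      rw [update_comm hts]

end Distribution

section Construction

variable {K P : Type} [Field K] [AddCommGroup P] [Module K P]

/-- The brace recursion, iterated at most `n` times. -/
def braceAux (m : P →ₗ[K] P →ₗ[K] P) (x : P) : ℕ → List P → P
  | 0, _ => x
  | _ + 1, [] => x
  | n + 1, y :: l => m (braceAux m x n l) y - derivSum (fun z => m z y) l (braceAux m x n)

/-- The braces of a pre-Lie product, defined by the recursion
`x⟨y, l⟩ = x⟨l⟩ ∘ y - ∑ x⟨l with one entry z replaced by z ∘ y⟩`. -/
def brace (m : P →ₗ[K] P →ₗ[K] P) (x : P) (l : List P) : P :=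
  braceAux m x l.length l

variable (m : P →ₗ[K] P →ₗ[K] P)

@[simp]
theorem brace_nil (x : P) : brace m x [] = x := rfl

theorem brace_cons (x y : P) (l : List P) :
    brace m x (y :: l) = m (brace m x l) y - derivSum (fun z => m z y) l (brace m x) := by
  simp only [brace, List.length_cons, braceAux]
  congr 1
  exact derivSum_congr _ _ fun l' hl' => by rw [brace, hl']

theorem brace_singleton (x y : P) : brace m x [y] = m x y := by
  simp [brace_cons, derivSum]

/-- Linearity of a function of lists in every entry. -/
def EntryLinear (F : List P → P) : Prop :=
  ∀ (l₁ : List P) (c : K) (y y' : P) (l₂ : List P),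
    F (l₁ ++ (c • y + y') :: l₂) = c • F (l₁ ++ y :: l₂) + F (l₁ ++ y' :: l₂)

theorem derivSum_smul_add (d : P → P) (l : List P) (c : K) (F G : List P → P) :
    derivSum d l (fun l' => c • F l' + G l') = c • derivSum d l F + derivSum d l G := by
  rw [derivSum_add]
  congr 1
  exact derivSum_map d l (DistribSMul.toAddMonoidHom P c) F

theorem brace_head (c : K) (x x' : P) (l : List P) :
    brace m (c • x + x') l = c • brace m x l + brace m x' l := by
  induction h : l.length generalizing l with
  | zero => simp [List.length_eq_zero_iff.mp h]
  | succ n ih =>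
    obtain ⟨y, l, rfl⟩ := List.exists_cons_of_length_eq_add_one h
    simp only [List.length_cons, Nat.add_right_cancel_iff] at h
    rw [brace_cons, brace_cons, brace_cons, ih l h,
      derivSum_congr _ l fun l' hl' => ih l' (hl'.trans h), derivSum_smul_add]
    simp only [map_add, map_smul, LinearMap.add_apply, LinearMap.smul_apply, smul_sub]
    abel

theorem derivSum_mul_linear (F : List P → P) (n : ℕ)
    (hF : ∀ (l₁ : List P) (c : K) (y y' : P) (l₂ : List P), l₁.length + 1 + l₂.length = n →
      F (l₁ ++ (c • y + y') :: l₂) = c • F (l₁ ++ y :: l₂) + F (l₁ ++ y' :: l₂))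
    (c : K) (y y' : P) (l : List P) (hl : l.length = n) :
    derivSum (fun z => m z (c • y + y')) l F =
      c • derivSum (fun z => m z y) l F + derivSum (fun z => m z y') l F := by
  induction l generalizing F n with
  | nil => simp [derivSum]
  | cons z l ih =>
    have h₁ : F (m z (c • y + y') :: l) = c • F (m z y :: l) + F (m z y' :: l) := by
      simpa using hF [] c (m z y) (m z y') l (by simp at hl ⊢; omega)
    simp only [derivSum]
    rw [h₁, ih (fun l' => F (z :: l')) l.length
      (fun l₁ c y y' l₂ h => hF (z :: l₁) c y y' l₂ (by simp at hl ⊢; omega)) rfl, smul_add]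
    abel

theorem brace_entryLinear (x : P) : EntryLinear (K := K) (brace m x) := by
  suffices h : ∀ n (l₁ : List P) (c : K) (y y' : P) (l₂ : List P), l₁.length + 1 + l₂.length = n →
      brace m x (l₁ ++ (c • y + y') :: l₂) =
        c • brace m x (l₁ ++ y :: l₂) + brace m x (l₁ ++ y' :: l₂) from
    fun l₁ c y y' l₂ => h _ l₁ c y y' l₂ rfl
  intro n
  induction n with
  | zero => intro l₁ c y y' l₂ h; omega
  | succ n ih =>
    intro l₁ c y y' l₂ h
    cases l₁ with
    | nil =>
      simp only [List.nil_append, brace_cons]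
      rw [derivSum_mul_linear m (brace m x) n ih c y y' l₂ (by simp at h; omega)]
      simp only [map_add, map_smul, smul_sub]
      abel
    | cons w l₁ =>
      have hn : l₁.length + 1 + l₂.length = n := by simp at h; omega
      simp only [List.cons_append, brace_cons, derivSum_append, derivSum]
      rw [ih l₁ c y y' l₂ hn,
        derivSum_congr _ l₁ fun l hl => ih l c y y' l₂ (by omega),
        derivSum_congr _ l₂ fun l hl => ih l₁ c y y' l (by omega),
        derivSum_smul_add, derivSum_smul_add]
      simp only [map_add, map_smul, LinearMap.add_apply, LinearMap.smul_apply]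
      rw [ih l₁ c _ _ l₂ hn]
      simp only [smul_sub, smul_add]
      abel

theorem EntryLinear.add {F : List P → P} (hF : EntryLinear (K := K) F) (l₁ : List P) (y y' : P)
    (l₂ : List P) : F (l₁ ++ (y + y') :: l₂) = F (l₁ ++ y :: l₂) + F (l₁ ++ y' :: l₂) := by
  simpa using hF l₁ 1 y y' l₂

theorem EntryLinear.smul {F : List P → P} (hF : EntryLinear (K := K) F) (l₁ : List P) (c : K)
    (y : P) (l₂ : List P) : F (l₁ ++ (c • y) :: l₂) = c • F (l₁ ++ y :: l₂) := by
  have h₀ : F (l₁ ++ 0 :: l₂) = 0 := by simpa using hF.add l₁ 0 0 l₂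
  simpa [h₀] using hF l₁ c y 0 l₂

theorem EntryLinear.cons {F : List P → P} (hF : EntryLinear (K := K) F) (z : P) :
    EntryLinear (K := K) fun l => F (z :: l) :=
  fun l₁ => hF (z :: l₁)

/-- The right pre-Lie identity. -/
def IsPreLie (m : P →ₗ[K] P →ₗ[K] P) : Prop :=
  ∀ x y z, m (m x y) z - m x (m y z) = m (m x z) y - m x (m z y)

variable {m}

theorem IsPreLie.derivSum_derivSum (hm : IsPreLie m) {F : List P → P}
    (hF : EntryLinear (K := K) F) (y z : P) (l : List P) :
    derivSum (fun w => m w y) l (fun l' => derivSum (fun w => m w z) l' F) +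
        derivSum (fun w => m w (m z y)) l F =
      derivSum (fun w => m w z) l (fun l' => derivSum (fun w => m w y) l' F) +
        derivSum (fun w => m w (m y z)) l F := by
  induction l generalizing F with
  | nil => simp [derivSum]
  | cons w l ih =>
    simp only [derivSum, derivSum_add]
    have h₁ := ih (hF.cons w)
    have h₂ := hF.add [] (m (m w y) z) (m w (m z y)) l
    have h₃ := hF.add [] (m (m w z) y) (m w (m y z)) l
    have h₄ : m (m w y) z + m w (m z y) = m (m w z) y + m w (m y z) := by
      have := hm w y z
      rw [sub_eq_sub_iff_add_eq_add] at this
      exact this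
    rw [h₄, h₃] at h₂
    simp only [List.nil_append] at h₂
    linear_combination (norm := abel) h₁ - h₂

theorem IsPreLie.brace_swap (hm : IsPreLie m) (x : P) (l₁ : List P) (y z : P) (l₂ : List P) :
    brace m x (l₁ ++ y :: z :: l₂) = brace m x (l₁ ++ z :: y :: l₂) := by
  induction h : l₁.length + l₂.length generalizing l₁ y z l₂ with
  | zero =>
    obtain rfl : l₁ = [] := List.length_eq_zero_iff.mp (by omega)
    obtain rfl : l₂ = [] := List.length_eq_zero_iff.mp (by omega)
    simpa [brace_cons, derivSum] using hm x z y
  | succ n ih =>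
    cases l₁ with
    | nil =>
      have h₁ := hm.derivSum_derivSum (brace_entryLinear m x) y z l₂
      have h₂ := hm (brace m x l₂) y z
      have h₃ : ∀ u v : P, derivSum (fun w => m w u) l₂ (fun l => m (brace m x l) v) =
          m (derivSum (fun w => m w u) l₂ (brace m x)) v := fun u v =>
        derivSum_map _ l₂ (m.flip v).toAddMonoidHom (brace m x)
      simp only [List.nil_append, brace_cons, derivSum, derivSum_sub, h₃, map_sub,
        LinearMap.sub_apply]
      linear_combination (norm := abel) h₁ - h₂
    | cons w l₁ =>
      simp only [List.length_cons] at h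
      simp only [List.cons_append, brace_cons, derivSum_append, derivSum]
      rw [ih l₁ y z l₂ (by omega), derivSum_congr _ l₁ fun l hl => ih l y z l₂ (by omega),
        derivSum_congr _ l₂ fun l hl => ih l₁ y z l (by omega), ih l₁ _ z l₂ (by omega),
        ih l₁ y _ l₂ (by omega)]
      abel

end Construction

section CompositionTerm

variable {A : Type}

theorem perm_invariant {F : List A → A}
    (hF : ∀ l₁ y z l₂, F (l₁ ++ y :: z :: l₂) = F (l₁ ++ z :: y :: l₂)) {l l' : List A}
    (h : l.Perm l') : F l = F l' := by
  induction h generalizing F with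
  | nil => rfl
  | cons w _ ih => exact ih (F := fun l => F (w :: l)) fun l₁ => hF (w :: l₁)
  | swap y z l => exact hF [] z y l
  | trans _ _ ih₁ ih₂ => exact (ih₁ hF).trans (ih₂ hF)

/-- The summand `x⟨x₁⟨c₁⟩, …, x_m⟨c_m⟩, c_{m+1}⟩` of the composition axiom. -/
def compTerm (b : A → List A → A) (x : A) (xs : List A) (c : Fin (xs.length + 1) → List A) : A :=
  b x (List.ofFn (fun t => b (xs.get t) (c t.castSucc)) ++ c (Fin.last _))

theorem compTerm_update_castSucc (b : A → List A → A) (x : A) (xs : List A)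
    (c : Fin (xs.length + 1) → List A) (t : Fin xs.length) (l : List A) :
    compTerm b x xs (update c t.castSucc l) =
      b x (List.ofFn (update (fun s => b (xs.get s) (c s.castSucc)) t (b (xs.get t) l)) ++
        c (Fin.last _)) := by
  unfold compTerm
  rw [update_of_ne (Fin.castSucc_lt_last t).ne']
  congr 3
  funext s
  by_cases hs : s = t
  · subst hs; simp
  · rw [update_of_ne hs, update_of_ne (by simpa using hs)]

theorem compTerm_update_last (b : A → List A → A) (x : A) (xs : List A)
    (c : Fin (xs.length + 1) → List A) (l : List A) :
    compTerm b x xs (update c (Fin.last _) l) =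
      b x (List.ofFn (fun t => b (xs.get t) (c t.castSucc)) ++ l) := by
  unfold compTerm
  congr 2
  · congr 1
    funext t
    rw [update_of_ne (Fin.castSucc_lt_last t).ne]
  · simp

theorem ofFn_update_eq {n : ℕ} (g : Fin n → A) (t : Fin n) :
    ∃ l₁ l₂, ∀ y, List.ofFn (update g t y) = l₁ ++ y :: l₂ := by
  induction n with
  | zero => exact t.elim0
  | succ n ih =>
    induction t using Fin.cases with
    | zero =>
      exact ⟨[], List.ofFn fun i => g i.succ, fun y => by
        simp [List.ofFn_succ, update_of_ne]⟩
    | succ t =>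
      obtain ⟨l₁, l₂, h⟩ := ih (fun i => g i.succ) t
      refine ⟨g 0 :: l₁, l₂, fun y => ?_⟩
      rw [List.cons_append, ← h, List.ofFn_succ, update_of_ne (Fin.succ_ne_zero t).symm]
      congr 2
      funext i
      by_cases hi : i = t
      · subst hi; simp
      · rw [update_of_ne hi, update_of_ne (by simpa using hi)]

end CompositionTerm

section Composition

variable {K P : Type} [Field K] [AddCommGroup P] [Module K P]

theorem sum_compTerm (b : P → List P → P) (x : P) (xs ys : List P) :
    (∑ f : Fin ys.length → Fin (xs.length + 1),
        b x
          (((List.finRange xs.length).map fun t =>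
              b (xs.get t)
                (((List.finRange ys.length).filter fun j => (f j : ℕ) = (t : ℕ)).map ys.get)) ++
            ((List.finRange ys.length).filter fun j => (f j : ℕ) = xs.length).map ys.get)) =
      distribSum ys (compTerm b x xs) := by
  rw [distribSum_eq_sum]
  refine Finset.sum_congr rfl fun f _ => ?_
  simp only [compTerm, block, Fin.ext_iff, Fin.val_castSucc, Fin.val_last, List.ofFn_eq_map]

variable {m : P →ₗ[K] P →ₗ[K] P}

theorem brace_ofFn_update (x : P) {n : ℕ} (g : Fin n → P) (t : Fin n) (r : List P) :
    ∃ L : P →+ P, ∀ y, L y = brace m x (List.ofFn (update g t y) ++ r) := by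
  obtain ⟨l₁, l₂, h⟩ := ofFn_update_eq g t
  refine ⟨AddMonoidHom.mk' (fun y => brace m x (List.ofFn (update g t y) ++ r)) fun y y' => ?_,
    fun _ => rfl⟩
  simp only [h, List.append_assoc, List.cons_append]
  exact (brace_entryLinear m x).add l₁ y y' (l₂ ++ r)

theorem IsPreLie.mul_compTerm (hm : IsPreLie m) (x y : P) (xs : List P)
    (c : Fin (xs.length + 1) → List P) :
    m (compTerm (brace m) x xs c) y =
      ∑ t, (compTerm (brace m) x xs (push t y c) +
        derivSum (fun z => m z y) (c t) fun l => compTerm (brace m) x xs (update c t l)) := by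
  have h := brace_cons m x y
    (List.ofFn (fun t => brace m (xs.get t) (c t.castSucc)) ++ c (Fin.last _))
  rw [eq_sub_iff_add_eq] at h
  rw [compTerm, ← h, derivSum_append, derivSum_ofFn, Fin.sum_univ_castSucc]
  have hlast : brace m x
      (y :: (List.ofFn (fun t => brace m (xs.get t) (c t.castSucc)) ++ c (Fin.last _))) =
      compTerm (brace m) x xs (push (Fin.last _) y c) := by
    rw [push, compTerm_update_last]
    exact perm_invariant (hm.brace_swap x) List.perm_middle.symm
  have hcast : ∀ t : Fin xs.length,
      brace m x (List.ofFn (update (fun t => brace m (xs.get t) (c t.castSucc)) t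
        (m (brace m (xs.get t) (c t.castSucc)) y)) ++ c (Fin.last _)) =
      compTerm (brace m) x xs (push t.castSucc y c) +
        derivSum (fun z => m z y) (c t.castSucc) fun l =>
          compTerm (brace m) x xs (update c t.castSucc l) := by
    intro t
    obtain ⟨L, hL⟩ := brace_ofFn_update (m := m) x
      (fun t => brace m (xs.get t) (c t.castSucc)) t (c (Fin.last _))
    have h' := brace_cons m (xs.get t) y (c t.castSucc)
    rw [eq_sub_iff_add_eq] at h'
    simp only [push, compTerm_update_castSucc, ← hL]
    rw [← h', map_add, derivSum_map]
  simp only [hlast, hcast, compTerm_update_last]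
  abel

theorem IsPreLie.brace_brace (hm : IsPreLie m) (x : P) (xs ys : List P) :
    brace m (brace m x xs) ys = distribSum ys (compTerm (brace m) x xs) := by
  induction h : ys.length generalizing ys with
  | zero =>
    obtain rfl := List.length_eq_zero_iff.mp h
    simp only [distribSum, compTerm, brace_nil, List.append_nil]
    simp
  | succ n ih =>
    obtain ⟨y, ys, rfl⟩ := List.exists_cons_of_length_eq_add_one h
    simp only [List.length_cons, Nat.add_right_cancel_iff] at h
    rw [brace_cons, ih ys h, derivSum_congr _ ys fun l hl => ih l (hl.trans h),
      derivSum_distribSum, distribSum, ← distribSum_sum, sub_eq_iff_eq_add, ← distribSum_add]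
    simp only [← Finset.sum_add_distrib, ← hm.mul_compTerm]
    exact (distribSum_map ys (m.flip y).toAddMonoidHom _).symm

/-- The symmetric brace algebra of a pre-Lie algebra. -/
def IsPreLie.symBrace (hm : IsPreLie m) : NGSymBrace K P where
  brace := brace m
  brace_nil := brace_nil m
  add_head x y l := by simpa using brace_head m 1 x y l
  smul_head c x l := by
    have h₀ : brace m 0 l = 0 := by simpa using brace_head m 1 0 0 l
    simpa [h₀] using brace_head m c x 0 l
  add_entry x := (brace_entryLinear m x).add
  smul_entry x := (brace_entryLinear m x).smul
  symm := hm.brace_swap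
  comp x xs ys := by rw [hm.brace_brace, sum_compTerm]

end Composition

section Uniqueness

variable {K P Q : Type} [Field K] [AddCommGroup P] [Module K P] [AddCommGroup Q] [Module K Q]

/-- The braces of a symmetric brace algebra obey the recursion defining those of its
one-argument brace. -/
theorem symBrace_cons (S : NGSymBrace K P) (x y : P) (l : List P) :
    S.brace x (y :: l) =
      S.brace (S.brace x l) [y] - derivSum (fun z => S.brace z [y]) l (S.brace x) := by
  have hl : derivSum (fun z => S.brace z [y]) l (S.brace x) =
      derivSum (fun z => S.brace z [y]) (List.ofFn l.get) (S.brace x) := by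
    rw [List.ofFn_get]
  have hp : S.brace x (y :: l) = S.brace x (l ++ [y]) :=
    perm_invariant (S.symm x) (List.perm_append_singleton y l).symm
  rw [eq_sub_iff_add_eq, S.comp, sum_compTerm, hl, derivSum_ofFn, hp]
  simp only [distribSum, push, Fin.sum_univ_castSucc, compTerm_update_castSucc,
    compTerm_update_last, S.brace_nil, List.append_nil]
  rw [List.ofFn_get, add_comm]

theorem map_symBrace (S : NGSymBrace K P) (T : NGSymBrace K Q) (ψ : P →+ Q)
    (hψ : ∀ x y, ψ (S.brace x [y]) = T.brace (ψ x) [ψ y]) (x : P) (l : List P) :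
    ψ (S.brace x l) = T.brace (ψ x) (l.map ψ) := by
  induction h : l.length generalizing l with
  | zero => simp [List.length_eq_zero_iff.mp h, S.brace_nil, T.brace_nil]
  | succ n ih =>
    obtain ⟨y, l, rfl⟩ := List.exists_cons_of_length_eq_add_one h
    simp only [List.length_cons, Nat.add_right_cancel_iff] at h
    rw [List.map_cons, symBrace_cons S x, symBrace_cons T (ψ x), map_sub, hψ, ih l h, ← derivSum_map,
      derivSum_congr _ l fun l' hl' => ih l' (hl'.trans h),
      derivSum_list_map ψ (fun z => S.brace z [y]) _ fun z => hψ z y]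

theorem symBrace_ext {S T : NGSymBrace K P} (h : ∀ x y, S.brace x [y] = T.brace x [y]) :
    S = T := by
  have hb : S.brace = T.brace := by
    funext x l
    simpa using map_symBrace S T (AddMonoidHom.id P) h x l
  cases S
  cases T
  cases hb
  rfl

end Uniqueness

end PreLie

/-- Proposition 3.4, Guin–Oudom. Every non-graded right pre-Lie
algebra `(P, ∘)` carries a unique symmetric brace algebra structure whose one-argument
brace is the pre-Lie product, and every homomorphism of pre-Lie algebras is
automatically a homomorphism of the corresponding symmetric brace algebras; hence the
category of non-graded symmetric brace algebras is isomorphic to the category of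
non-graded right pre-Lie algebras. -/
theorem stmt9 (K P : Type) [Field K] [AddCommGroup P] [Module K P]
    (mul : P → P → P)
    (hadd₁ : ∀ x y z, mul (x + y) z = mul x z + mul y z)
    (hsmul₁ : ∀ (c : K) x z, mul (c • x) z = c • mul x z)
    (hadd₂ : ∀ x y z, mul x (y + z) = mul x y + mul x z)
    (hsmul₂ : ∀ (c : K) x z, mul x (c • z) = c • mul x z)
    (hpre : ∀ x y z,
      mul (mul x y) z - mul x (mul y z) = mul (mul x z) y - mul x (mul z y)) :
    (∃! S : NGSymBrace K P, ∀ x y : P, S.brace x [y] = mul x y) ∧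
    (∀ (Q : Type) [AddCommGroup Q] [Module K Q],
      ∀ (SP : NGSymBrace K P) (SQ : NGSymBrace K Q) (ψ : P →ₗ[K] Q),
        (∀ x y : P, ψ (SP.brace x [y]) = SQ.brace (ψ x) [ψ y]) →
        ∀ (x : P) (l : List P),
          ψ (SP.brace x l) = SQ.brace (ψ x) (l.map fun y => ψ y)) := by
  have hm : PreLie.IsPreLie (LinearMap.mk₂ K mul hadd₁ hsmul₁ hadd₂ hsmul₂) := hpre
  refine ⟨⟨hm.symBrace, PreLie.brace_singleton _, fun T hT => ?_⟩, ?_⟩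
  · exact PreLie.symBrace_ext fun x y => (hT x y).trans
      (PreLie.brace_singleton (LinearMap.mk₂ K mul hadd₁ hsmul₁ hadd₂ hsmul₂) x y).symm
  · intro Q _ _ SP SQ ψ hψ
    exact PreLie.map_symBrace SP SQ ψ.toAddMonoidHom hψ
end
end

section
/- (Lemma 4.2, identity (bb), componentwise form) Let B be a symmetric brace algebra, and let a, b, c ∈ B be homogeneous with b of degree −1 and c of even degree. Writing c^{(n)} for n repeated arguments c, one has for every n ≥ 0: a⟨b⟩⟨c^{(n)}⟩ = Σ_{k=0}^{n} (n choose k) · a⟨b⟨c^{(k)}⟩, c^{(n−k)}⟩. Equivalently, with exp(c) := Σ_{n≥0} c^{(n)}/n! interpreted termwise, a⟨b⟩⟨exp c⟩ = a⟨b⟨exp c⟩, exp c⟩. -/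
open scoped Classical

noncomputable section

/-- A (ℤ-graded) symmetric brace algebra on a graded vector space `B` with grading `𝒜`.
The braces take a head element and a (finite) list of arguments; they are multilinear,
of degree `0`, graded symmetric in the list arguments, satisfy `x⟨⟩ = x` and the
composition axiom, in which the sum runs over all decompositions of the arguments
`y₁,…,yₙ` into `m+1` blocks (encoded by a function `f` assigning to each `yⱼ` a block),
each block listed in increasing order of indices, with the Koszul sign of the permutation
placing each block of `y`'s after its `xᵢ`. -/
structure SymBraceAlg (K B : Type*) [Field K] [AddCommGroup B] [Module K B]
    (𝒜 : ℤ → Submodule K B) where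
  brace : B → List B → B
  brace_nil : ∀ x, brace x [] = x
  add_head : ∀ x y l, brace (x + y) l = brace x l + brace y l
  smul_head : ∀ (c : K) (x : B) l, brace (c • x) l = c • brace x l
  add_entry : ∀ x l₁ (y y' : B) l₂,
    brace x (l₁ ++ (y + y') :: l₂) = brace x (l₁ ++ y :: l₂) + brace x (l₁ ++ y' :: l₂)
  smul_entry : ∀ x l₁ (c : K) (y : B) l₂,
    brace x (l₁ ++ (c • y) :: l₂) = c • brace x (l₁ ++ y :: l₂)
  mem_deg : ∀ (x : B) (dx : ℤ) (l : List B) (dl : List ℤ), x ∈ 𝒜 dx →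
    List.Forall₂ (fun y e => y ∈ 𝒜 e) l dl → brace x l ∈ 𝒜 (dx + dl.sum)
  symm : ∀ x l₁ (y z : B) l₂ (dy dz : ℤ), y ∈ 𝒜 dy → z ∈ 𝒜 dz →
    brace x (l₁ ++ y :: z :: l₂) = ((-1 : K) ^ (dy * dz)) • brace x (l₁ ++ z :: y :: l₂)
  comp : ∀ (x : B) (xs ys : List B) (dxs dys : List ℤ),
    List.Forall₂ (fun y e => y ∈ 𝒜 e) xs dxs →
    List.Forall₂ (fun y e => y ∈ 𝒜 e) ys dys →
    brace (brace x xs) ys =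
      ∑ f : Fin ys.length → Fin (xs.length + 1),
        ((-1 : K) ^
            ((∑ j : Fin ys.length,
                dys.getD (j : ℕ) 0 *
                  ∑ t ∈ Finset.univ.filter (fun t : Fin xs.length => (f j : ℕ) < (t : ℕ)),
                    dxs.getD (t : ℕ) 0) +
              ∑ pr : Fin ys.length × Fin ys.length,
                if pr.1 < pr.2 ∧ (f pr.2 : ℕ) < (f pr.1 : ℕ) then
                  dys.getD (pr.1 : ℕ) 0 * dys.getD (pr.2 : ℕ) 0
                else 0)) •
          brace x
            (((List.finRange xs.length).map fun t =>
                brace (xs.get t)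
                  (((List.finRange ys.length).filter fun j => (f j : ℕ) = (t : ℕ)).map ys.get)) ++
              ((List.finRange ys.length).filter fun j => (f j : ℕ) = xs.length).map ys.get)

/-- A sum over the two-block decompositions of `Fin n` of a function of the size of the first
block. -/
theorem sum_fin_two_fun_apply_card {M : Type*} [AddCommMonoid M] (n : ℕ) (g : ℕ → M) :
    ∑ f : Fin n → Fin 2, g (Finset.univ.filter fun j => (f j : ℕ) = 0).card =
      ∑ k ∈ Finset.range (n + 1), n.choose k • g k := by
  have h := Finset.sum_powerset_apply_card g (x := (Finset.univ : Finset (Fin n)))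
  rw [Finset.card_univ, Fintype.card_fin] at h
  rw [← h]
  refine Finset.sum_bij' (fun f _ => Finset.univ.filter fun j => (f j : ℕ) = 0)
    (fun s _ x => if x ∈ s then 0 else 1) ?_ ?_ ?_ ?_ ?_
  · simp
  · simp
  · intro f _
    funext x
    simp only [Finset.mem_filter, Finset.mem_univ, true_and]
    generalize f x = i
    fin_cases i <;> rfl
  · intro s _
    ext x
    by_cases hx : x ∈ s <;> simp [hx]
  · simp

/-- Selecting entries of a constant list yields a constant list. -/
theorem map_get_filter_finRange_of_forall_eq {B : Type*} {c : B} {ys : List B}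
    (h : ∀ y ∈ ys, y = c) (p : Fin ys.length → Prop) [DecidablePred p] :
    ((List.finRange ys.length).filter fun j => p j).map ys.get =
      List.replicate (Finset.univ.filter p).card c := by
  rw [List.eq_replicate_iff]
  constructor
  · rw [List.length_map, ← List.toFinset_card_of_nodup ((List.nodup_finRange _).filter _)]
    congr 1
    ext j
    simp
  · intro y hy
    obtain ⟨j, -, rfl⟩ := List.mem_map.1 hy
    exact h _ (List.get_mem _ _)

/-- Lemma 4.2, identity (bb), componentwise form. For homogeneous
`a`, `b` of degree `−1` and `c` of even degree, and every `n ≥ 0`: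
`a⟨b⟩⟨c^{(n)}⟩ = Σ_{k=0}^{n} (n choose k) · a⟨b⟨c^{(k)}⟩, c^{(n−k)}⟩`. -/
theorem stmt11 (K B : Type*) [Field K] [AddCommGroup B] [Module K B]
    (𝒜 : ℤ → Submodule K B) [DirectSum.Decomposition 𝒜]
    (S : SymBraceAlg K B 𝒜) (a b c : B) (da dc : ℤ)
    (ha : a ∈ 𝒜 da) (hb : b ∈ 𝒜 (-1)) (hc : c ∈ 𝒜 dc) (hdc : Even dc) :
    ∀ n : ℕ,
      S.brace (S.brace a [b]) (List.replicate n c) =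
        ∑ k ∈ Finset.range (n + 1),
          (n.choose k : K) •
            S.brace a (S.brace b (List.replicate k c) :: List.replicate (n - k) c) := by
  intro n
  obtain ⟨ys, hys⟩ : ∃ ys, ys = List.replicate n c := ⟨_, rfl⟩
  have hmem : ∀ y ∈ ys, y = c := fun y hy => List.eq_of_mem_replicate (hys ▸ hy)
  have hlen : ys.length = n := by simp [hys]
  have hdeg : List.Forall₂ (fun y e => y ∈ 𝒜 e) ys (List.replicate n dc) := by
    rw [hys, List.forall₂_iff_get]
    simp [hc]
  have heven : ∀ i, Even ((List.replicate n dc).getD i 0) := by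
    intro i
    rw [List.getD_eq_getElem?_getD, List.getElem?_replicate]
    split_ifs <;> simp [hdc]
  rw [← hys, S.comp a [b] ys [-1] (List.replicate n dc) (.cons hb .nil) hdeg]
  subst hlen
  have hsum := sum_fin_two_fun_apply_card ys.length fun k =>
    S.brace a (S.brace b (List.replicate k c) :: List.replicate (ys.length - k) c)
  simp only [← Nat.cast_smul_eq_nsmul K] at hsum
  rw [← hsum]
  refine Finset.sum_congr rfl fun f _ => ?_
  have hsign : ∀ e : ℤ, Even e → (-1 : K) ^ e = 1 := fun e he => he.neg_one_zpow
  rw [hsign, one_smul, map_get_filter_finRange_of_forall_eq hmem]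
  · have hcard : (Finset.univ.filter fun j => (f j : ℕ) = [b].length).card =
        ys.length - (Finset.univ.filter fun j => (f j : ℕ) = 0).card := by
      have h := Finset.card_filter_add_card_filter_not (s := Finset.univ)
        (fun j => (f j : ℕ) = 0)
      rw [Finset.card_univ, Fintype.card_fin] at h
      have h' : (Finset.univ.filter fun j => (f j : ℕ) = [b].length) =
          Finset.univ.filter fun j => ¬ (f j : ℕ) = 0 := by
        ext j
        have := (f j).isLt
        simp only [List.length_singleton] at this
        simp only [Finset.mem_filter, Finset.mem_univ, true_and, List.length_singleton]
        omega
      rw [h']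
      omega
    rw [hcard]
    congr 1
    change [S.brace b _] ++ _ = _
    rw [map_get_filter_finRange_of_forall_eq hmem]
    rfl
  · refine Even.add (Finset.even_sum _ fun j _ => (heven _).mul_right _)
      (Finset.even_sum _ fun p _ => ?_)
    split_ifs
    · exact (heven _).mul_right _
    · exact Even.zero
end
end

section
/- (A∞ master equation for the transfer) Let (V,∂_V), (W,∂_W) be chain complexes over a field of characteristic 0, f : V → W, g : W → V chain maps, and let Φ(u) := f ∘ u ∘ g^{⊗n} for u ∈ Hom(V^{⊗n},V). Suppose p̄ = Σ_{n≥2} p_n, with p_n ∈ Hom(V^{⊗n},V) of internal degree n − 1, satisfies ∂p̄ + p̄{gf∘p̄} = 0 (componentwise in each arity), where ∂u := ∂_V∘u − (−1)^{|u|} u{∂_V} is the Hom-differential and {−} the Getzler–Voronov brace. Then ν̄ := Φ(p̄) satisfies the master equation ∂ν̄ + ν̄{ν̄} = 0 componentwise; consequently ν₁ := ∂_W together with ν_n := f ∘ p_n ∘ g^{⊗n} (n ≥ 2) forms an A∞-structure on W. -/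
open scoped Classical

noncomputable section

/-- `k`-multilinear maps `V^{⊗k} → V`. -/
abbrev MLMap (K V : Type) [Field K] [AddCommGroup V] [Module K V] (k : ℕ) :=
  MultilinearMap K (fun _ : Fin k => V) V

/-- Extension of a `Fin r`-tuple to a function on `ℕ` (by `0`). -/
def extO {α : Type} [Zero α] (r : ℕ) (v : Fin r → α) : ℕ → α :=
  fun m => if h : m < r then v ⟨m, h⟩ else 0

/-- Exponent of the Koszul sign of the permutation sending `(x₁,…,x_r)` (with degrees `d`)
to `(x_{σ(1)},…,x_{σ(r)})`: a pair of target positions `p₁ < p₂` is inverted iff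
`σ p₂ < σ p₁`, contributing `d (σ p₁) * d (σ p₂)`. -/
def koszulExp {r : ℕ} (d : Fin r → ℤ) (σ : Equiv.Perm (Fin r)) : ℤ :=
  ∑ pr : Fin r × Fin r,
    if pr.1 < pr.2 ∧ σ pr.2 < σ pr.1 then d (σ pr.1) * d (σ pr.2) else 0

/-- The Koszul sign `ε(σ)` (as an element of the ground field). -/
def koszulSign (K : Type) [Field K] {r : ℕ} (d : Fin r → ℤ) (σ : Equiv.Perm (Fin r)) : K :=
  (-1 : K) ^ koszulExp d σ

/-- The antisymmetric Koszul sign `χ(σ) = sgn(σ)·ε(σ)`. -/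
def aKoszulSign (K : Type) [Field K] {r : ℕ} (d : Fin r → ℤ) (σ : Equiv.Perm (Fin r)) : K :=
  ((Equiv.Perm.sign σ : ℤ) : K) * koszulSign K d σ

section Graded

variable {K V : Type} [Field K] [AddCommGroup V] [Module K V]

/-- `f` has internal degree `p` with respect to the grading `𝒱`. -/
def HasDeg (𝒱 : ℤ → Submodule K V) {k : ℕ} (p : ℤ) (f : MLMap K V k) : Prop :=
  ∀ (d : Fin k → ℤ) (v : Fin k → V), (∀ i, v i ∈ 𝒱 (d i)) →
    f v ∈ 𝒱 (p + ∑ i, d i)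

/-- `f` is antisymmetric (alternating): interchanging adjacent homogeneous arguments
multiplies the value by `−(−1)^{deg vᵢ · deg vᵢ₊₁}`. -/
def IsAntisym (𝒱 : ℤ → Submodule K V) {k : ℕ} (f : MLMap K V k) : Prop :=
  ∀ (d : Fin k → ℤ) (v : Fin k → V), (∀ i, v i ∈ 𝒱 (d i)) →
    ∀ (i : ℕ) (h1 : i < k) (h2 : i + 1 < k),
      f (v ∘ Equiv.swap ⟨i, h1⟩ ⟨i + 1, h2⟩) =
        (-((-1 : K) ^ (d ⟨i, h1⟩ * d ⟨i + 1, h2⟩))) • f v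

/-- `F` is the antisymmetrization `as(f)`, characterized on homogeneous tuples by
`as(f)(v₁,…,v_k) = Σ_{σ} χ(σ) f(v_{σ(1)},…,v_{σ(k)})`. -/
def IsAs (𝒱 : ℤ → Submodule K V) {k : ℕ} (f F : MLMap K V k) : Prop :=
  ∀ (d : Fin k → ℤ) (v : Fin k → V), (∀ i, v i ∈ 𝒱 (d i)) →
    F v = ∑ σ : Equiv.Perm (Fin k), aKoszulSign K d σ • f (fun i => v (σ i))

/-! ### The Getzler–Voronov (non-symmetric) brace -/

/-- Size of the `j`-th slot of `f` for an insertion pattern `s` (a strictly monotone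
map recording which slots of `f` receive `g₁,…,g_n`): `a t` if `s t = j`, else `1`. -/
def gvSize {k n : ℕ} (a : Fin n → ℕ) (s : Fin n → Fin k) (j : Fin k) : ℕ :=
  if h : ∃ t, s t = j then a h.choose else 1

/-- Offset in the argument string of the `j`-th slot of `f`. -/
def gvOff {k n : ℕ} (a : Fin n → ℕ) (s : Fin n → Fin k) (j : Fin k) : ℕ :=
  ∑ j' ∈ Finset.univ.filter (fun j' : Fin k => j' < j), gvSize a s j'

/-- The arguments handed to `f` in the Getzler–Voronov brace: slot `s t` receives
`g t` evaluated on its consecutive block of arguments, other slots receive single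
arguments. -/
def gvArg {K V : Type} [Field K] [AddCommGroup V] [Module K V] {k n : ℕ}
    (a : Fin n → ℕ) (g : ∀ t, MLMap K V (a t)) (s : Fin n → Fin k) (ve : ℕ → V) :
    Fin k → V :=
  fun j =>
    if h : ∃ t, s t = j then (g h.choose) (fun u => ve (gvOff a s j + (u : ℕ)))
    else ve (gvOff a s j)

/-- Exponent of the sign of one insertion pattern: `Σ_t |g_t| · Σ_{j ≤ i_t} (deg v_j − 1)`,
where `bq t` is the `B`-degree `|g_t|` and `i_t` the number of arguments before the
block of `g_t`. -/
def gvEps {k n : ℕ} (a : Fin n → ℕ) (bq : Fin n → ℤ) (s : Fin n → Fin k)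
    (de : ℕ → ℤ) : ℤ :=
  ∑ t : Fin n, bq t * ∑ m ∈ Finset.range (gvOff a s (s t)), (de m - 1)

/-- `F` is the Getzler–Voronov brace `f{g₁,…,g_n}` (with `g t` of arity `a t` and
internal degree `q t`), characterized on homogeneous tuples: the sum runs over all
order-preserving non-overlapping insertions of the `g`'s into the slots of `f`. -/
def IsGVBrace (𝒱 : ℤ → Submodule K V) {k n r : ℕ} (a : Fin n → ℕ) (q : Fin n → ℤ)
    (f : MLMap K V k) (g : ∀ t, MLMap K V (a t)) (F : MLMap K V r) : Prop :=
  ∀ (d : Fin r → ℤ) (v : Fin r → V), (∀ i, v i ∈ 𝒱 (d i)) →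
    F v = ∑ s ∈ Finset.univ.filter (fun s : Fin n → Fin k => StrictMono s),
      ((-1 : K) ^ gvEps a (fun t => q t - (a t : ℤ) + 1) s (extO r d)) •
        f (gvArg a g s (extO r v))

/-- The Getzler–Voronov brace with a single argument. -/
def IsGVBrace1 (𝒱 : ℤ → Submodule K V) {k m r : ℕ} (q : ℤ)
    (f : MLMap K V k) (g : MLMap K V m) (F : MLMap K V r) : Prop :=
  IsGVBrace 𝒱 (fun _ : Fin 1 => m) (fun _ => q) f (fun _ => g) F

/-! ### The symmetric brace on antisymmetric maps -/

/-- Prefix sums of the arities `a` of the brace arguments. -/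
def sbApref {n : ℕ} (a : Fin n → ℕ) (t : ℕ) : ℕ :=
  ∑ t' ∈ Finset.range t, extO n a t'

/-- The block (`0,…,n−1` for the arguments of `g₁,…,g_n`, `n` for the remaining plain
slots) containing position `m` of the argument string. -/
def sbBlockOf {n : ℕ} (a : Fin n → ℕ) (m : ℕ) : ℕ :=
  ((Finset.range n).filter fun t => sbApref a (t + 1) ≤ m).card

/-- `σ` is an unshuffle for the block sizes `a₁,…,a_n, r − Σa`: it is strictly
increasing within each block. -/
def sbIsUnshuffle (n : ℕ) (a : Fin n → ℕ) {r : ℕ} (σ : Equiv.Perm (Fin r)) : Prop :=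
  ∀ u u' : Fin r, u < u' → sbBlockOf a (u : ℕ) = sbBlockOf a (u' : ℕ) → σ u < σ u'

/-- The sign exponent `δ = (k−1)q₁ + (k−2+a₁)q₂ + ⋯ + (k−n+a₁+⋯+a_{n−1})q_n
+ Σ_{i<j} aᵢaⱼ + (n−1)a₁ + (n−2)a₂ + ⋯ + a_{n−1}`. -/
def sbDelta (k n : ℕ) (a : Fin n → ℕ) (q : Fin n → ℤ) : ℤ :=
  (∑ t : Fin n,
      ((k : ℤ) - ((t : ℕ) + 1) + ∑ t' ∈ Finset.range (t : ℕ), ((extO n a t' : ℕ) : ℤ)) * q t) +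
    (∑ pr : Fin n × Fin n, if pr.1 < pr.2 then (a pr.1 : ℤ) * (a pr.2 : ℤ) else 0) +
    ∑ t : Fin n, ((n : ℤ) - 1 - (t : ℕ)) * (a t : ℤ)

/-- The arguments handed to `f` in `f(g₁⊗…⊗g_n⊗id^{⊗(k−n)})(v_{i₁},…,v_{i_r})`:
slot `t < n` receives `g t` on the `t`-th block of the unshuffled arguments `w`,
slots `n ≤ j < k` the remaining single arguments. -/
def sbArg {K V : Type} [Field K] [AddCommGroup V] [Module K V] {k n : ℕ}
    (a : Fin n → ℕ) (g : ∀ t, MLMap K V (a t)) (w : ℕ → V) : Fin k → V :=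
  fun j =>
    if h : (j : ℕ) < n then (g ⟨(j : ℕ), h⟩) (fun u => w (sbApref a (j : ℕ) + (u : ℕ)))
    else w (sbApref a n + ((j : ℕ) - n))

/-- `F` is the symmetric brace `f⟨g₁,…,g_n⟩` of antisymmetric maps (with `g t` of arity
`a t` and internal degree `q t`), characterized on homogeneous tuples:
`f⟨g₁,…,g_n⟩(v₁,…,v_r) = Σ (−1)^δ χ · f(g₁⊗…⊗g_n⊗id^{⊗(k−n)})(v_{i₁},…,v_{i_r})`,
the sum running over all unshuffles. -/
def IsSymBrace (𝒱 : ℤ → Submodule K V) {k n r : ℕ} (a : Fin n → ℕ) (q : Fin n → ℤ)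
    (f : MLMap K V k) (g : ∀ t, MLMap K V (a t)) (F : MLMap K V r) : Prop :=
  ∀ (d : Fin r → ℤ) (v : Fin r → V), (∀ i, v i ∈ 𝒱 (d i)) →
    F v = ∑ σ ∈ Finset.univ.filter (fun σ : Equiv.Perm (Fin r) => sbIsUnshuffle n a σ),
      (((-1 : K) ^ sbDelta k n a q) * aKoszulSign K d σ) •
        f (sbArg a g (extO r fun u => v (σ u)))

/-- The symmetric brace with a single argument. -/
def IsSymBrace1 (𝒱 : ℤ → Submodule K V) {k m r : ℕ} (q : ℤ)
    (f : MLMap K V k) (g : MLMap K V m) (F : MLMap K V r) : Prop :=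
  IsSymBrace 𝒱 (fun _ : Fin 1 => m) (fun _ => q) f (fun _ => g) F

end Graded

/-- `Φ(u) := f ∘ u ∘ g^{⊗n}`. -/
def PhiMap {K V W : Type} [Field K] [AddCommGroup V] [Module K V]
    [AddCommGroup W] [Module K W] (f : V →ₗ[K] W) (g : W →ₗ[K] V) {n : ℕ}
    (u : MLMap K V n) : MLMap K W n :=
  f.compMultilinearMap (u.compLinearMap fun _ => g)

theorem map_extO {K V W : Type} [Field K] [AddCommGroup V] [Module K V]
    [AddCommGroup W] [Module K W] (g : W →ₗ[K] V) (r : ℕ) (w : Fin r → W) (m : ℕ) :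
    g (extO r w m) = extO r (fun i => g (w i)) m := by
  unfold extO
  split_ifs <;> simp

/-- If the linear map precomposed by `Φ` intertwines two maps, then `Φ` intertwines
the braces with those maps inserted. -/
theorem IsGVBrace1.phiMap_apply {K V W : Type} [Field K] [AddCommGroup V] [Module K V]
    [AddCommGroup W] [Module K W] {𝒱 : ℤ → Submodule K V} {𝒲 : ℤ → Submodule K W}
    (f : V →ₗ[K] W) (g : W →ₗ[K] V) (hg : ∀ (m : ℤ) (x : W), x ∈ 𝒲 m → g x ∈ 𝒱 m)
    {k m r : ℕ} {q : ℤ} {p : MLMap K V k} {u : MLMap K V m} {u' : MLMap K W m}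
    (hu : ∀ w, g (u' w) = u (fun i => g (w i)))
    {F : MLMap K V r} {F' : MLMap K W r} (hF : IsGVBrace1 𝒱 q p u F)
    (hF' : IsGVBrace1 𝒲 q (PhiMap f g p) u' F') {d : Fin r → ℤ} {w : Fin r → W}
    (hw : ∀ i, w i ∈ 𝒲 (d i)) : F' w = f (F fun i => g (w i)) := by
  rw [hF' d w hw, hF d _ fun i => hg _ _ (hw i), map_sum]
  refine Finset.sum_congr rfl fun s _ => ?_
  rw [map_smul]
  congr 1
  change f (p fun j => g (gvArg _ _ s _ j)) = _
  congr 2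
  funext j
  unfold gvArg
  split_ifs with h
  · simp only [hu, map_extO]
  · exact map_extO g r w _

/-- `A∞` master equation for the transfer. Let `(V,∂_V)`, `(W,∂_W)` be
chain complexes, `f, g` chain maps, and `Φ(u) := f∘u∘g^{⊗n}`.  If `p̄ = Σ_{n≥2} p_n`
satisfies the master equation `∂p̄ + p̄{gf∘p̄} = 0` componentwise, where
`∂u := ∂_V∘u − (−1)^{|u|} u{∂_V}` (with `|p̄| = −1`), then `ν̄ := Φ(p̄)` satisfies
`∂ν̄ + ν̄{ν̄} = 0` componentwise; i.e. `ν₁ := ∂_W` together with `ν_n := f∘p_n∘g^{⊗n}`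
forms an `A∞`-structure on `W`.  `PD n _` is `p_n{∂_V}`, `PG m m' _` is `p_m{gf∘p_{m'}}`,
`ND n _` is `ν_n{∂_W}` and `NN m m' _` is `ν_m{ν_{m'}}`. -/
theorem stmt15 (K V W : Type) [Field K] [AddCommGroup V] [Module K V]
    [AddCommGroup W] [Module K W]
    (𝒱 : ℤ → Submodule K V) [DirectSum.Decomposition 𝒱]
    (𝒲 : ℤ → Submodule K W) [DirectSum.Decomposition 𝒲]
    (dV : V →ₗ[K] V) (hdVdeg : ∀ (m : ℤ) (x : V), x ∈ 𝒱 m → dV x ∈ 𝒱 (m - 1))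
    (hdV2 : ∀ x, dV (dV x) = 0)
    (dW : W →ₗ[K] W) (hdWdeg : ∀ (m : ℤ) (x : W), x ∈ 𝒲 m → dW x ∈ 𝒲 (m - 1))
    (hdW2 : ∀ x, dW (dW x) = 0)
    (f : V →ₗ[K] W) (hf : ∀ (m : ℤ) (x : V), x ∈ 𝒱 m → f x ∈ 𝒲 m)
    (hfc : ∀ x, f (dV x) = dW (f x))
    (g : W →ₗ[K] V) (hg : ∀ (m : ℤ) (x : W), x ∈ 𝒲 m → g x ∈ 𝒱 m)
    (hgc : ∀ x, g (dW x) = dV (g x))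
    (DV1 : MLMap K V 1) (hDV1 : ∀ v : Fin 1 → V, DV1 v = dV (v 0))
    (DW1 : MLMap K W 1) (hDW1 : ∀ w : Fin 1 → W, DW1 w = dW (w 0))
    (P : ∀ n : ℕ, MLMap K V n)
    (hPdeg : ∀ (n : ℕ), 2 ≤ n → HasDeg 𝒱 ((n : ℤ) - 2) (P n))
    (PD : ℕ → ∀ r : ℕ, MLMap K V r)
    (hPD : ∀ (n r : ℕ), 2 ≤ n → r = n →
      IsGVBrace1 𝒱 (-1 : ℤ) (P n) DV1 (PD n r))
    (PG : ℕ → ℕ → ∀ r : ℕ, MLMap K V r)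
    (hPG : ∀ (m m' r : ℕ), 2 ≤ m → 2 ≤ m' → r = m + m' - 1 →
      IsGVBrace1 𝒱 ((m' : ℤ) - 2) (P m) ((g.comp f).compMultilinearMap (P m'))
        (PG m m' r))
    (hmaster : ∀ (n : ℕ), 2 ≤ n → ∀ (d : Fin n → ℤ) (v : Fin n → V),
      (∀ i, v i ∈ 𝒱 (d i)) →
      (dV (P n v) - ((-1 : K) ^ (-1 : ℤ)) • PD n n v +
        ∑ m ∈ Finset.Icc 2 n, ∑ m' ∈ Finset.Icc 2 n,
          if m + m' = n + 1 then PG m m' n v else 0) = 0)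
    (ND : ℕ → ∀ r : ℕ, MLMap K W r)
    (hND : ∀ (n r : ℕ), 2 ≤ n → r = n →
      IsGVBrace1 𝒲 (-1 : ℤ) (PhiMap f g (P n)) DW1 (ND n r))
    (NN : ℕ → ℕ → ∀ r : ℕ, MLMap K W r)
    (hNN : ∀ (m m' r : ℕ), 2 ≤ m → 2 ≤ m' → r = m + m' - 1 →
      IsGVBrace1 𝒲 ((m' : ℤ) - 2) (PhiMap f g (P m)) (PhiMap f g (P m'))
        (NN m m' r)) :
    ∀ (n : ℕ), 2 ≤ n → ∀ (d : Fin n → ℤ) (w : Fin n → W),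
      (∀ i, w i ∈ 𝒲 (d i)) →
      (dW (PhiMap f g (P n) w) - ((-1 : K) ^ (-1 : ℤ)) • ND n n w +
        ∑ m ∈ Finset.Icc 2 n, ∑ m' ∈ Finset.Icc 2 n,
          if m + m' = n + 1 then NN m m' n w else 0) = 0 := by
  intro n hn d w hw
  have hD : ND n n w = f (PD n n fun i => g (w i)) :=
    (hPD n n hn rfl).phiMap_apply f g hg (by simp [hDV1, hDW1, hgc]) (hND n n hn rfl) hw
  have hN : ∀ m ∈ Finset.Icc 2 n, ∀ m' ∈ Finset.Icc 2 n,
      (if m + m' = n + 1 then NN m m' n w else 0) =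
        f (if m + m' = n + 1 then PG m m' n (fun i => g (w i)) else 0) := by
    intro m hm m' hm'
    rw [Finset.mem_Icc] at hm hm'
    split_ifs with h
    · have hr : n = m + m' - 1 := by omega
      exact (hPG m m' n hm.1 hm'.1 hr).phiMap_apply f g hg (fun _ => rfl)
        (hNN m m' n hm.1 hm'.1 hr) hw
    · simp
  have key := congrArg f (hmaster n hn d (fun i => g (w i)) fun i => hg _ _ (hw i))
  rw [map_zero, map_add, map_sub, map_smul, hfc, map_sum] at key
  rw [hD, Finset.sum_congr rfl fun m hm => Finset.sum_congr rfl (hN m hm)]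
  simp only [map_sum] at key ⊢
  exact key
end
end
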